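/- arXiv:1512.06693 — 2 statements merged into one kernel-verified Lean document; each statement's English description precedes it below -/
import Mathlib

section
/- Fix a bounded measurable set W ⊆ ℝ^d, a finite configuration y ⊂ ℝ^d, measurable functions h, φ : W → ℝ^p, a strictly positive Papangelou conditional intensity λ(u,y) (as a function of u ∈ ℝ^d and finite configurations y, measurable in u for the configurations y and y∪{u}), and a measurable function λ⁽¹⁾ : W → ℝ^p. Assume the integrability conditions: ∫_W |h_i(u) φ_j(u)| λ(u,y) du < ∞, ∫_W |h_i(u) λ⁽¹⁾_j(u)| du < ∞, and ∫_W ∫_W |h_i(u) φ_j(v)| { λ(u,y)λ(v,y) + λ(u,y)λ(v, y∪{u}) } du dv < ∞ for all i, j = 1,…,p. Then the matrix identity ∫_W h(u) φ(u)ᵀ λ(u,y) du + ∫_W ∫_W h(u) φ(v)ᵀ { λ(u,y)λ(v,y) − λ(u,y)λ(v, y∪{u}) } du dv − ∫_W h(u) λ⁽¹⁾(u)ᵀ du = ∫_W h(u) λ(u,y) { φ(u) − λ⁽¹⁾(u)/λ(u,y) + T_y φ(u) }ᵀ du holds, where T_y φ(u) = ∫_W φ(v) λ(v,y){1 − λ(v,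 y∪{u})/λ(v,y)} dv. -/
open MeasureTheory

/-- the key integral identity relating the covariance/sensitivity terms
of Takacs–Fiksel estimating functions to the term `A` involving the operator `T_y`.
Stated componentwise for the `p × p` matrix identity. -/
theorem statement_1 {d p : ℕ} [DecidableEq (EuclideanSpace ℝ (Fin d))]
    (W : Set (EuclideanSpace ℝ (Fin d))) (hWm : MeasurableSet W)
    (hWb : Bornology.IsBounded W)
    (y : Finset (EuclideanSpace ℝ (Fin d)))
    (h φ lam1 : EuclideanSpace ℝ (Fin d) → Fin p → ℝ)
    (lam : EuclideanSpace ℝ (Fin d) → Finset (EuclideanSpace ℝ (Fin d)) → ℝ)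
    (hpos : ∀ u z, 0 < lam u z)
    (hmh : Measurable h) (hmφ : Measurable φ) (hml1 : Measurable lam1)
    (hmlam : Measurable (fun u => lam u y))
    (hmlam2 : Measurable (fun q : EuclideanSpace ℝ (Fin d) × EuclideanSpace ℝ (Fin d) =>
      lam q.2 (insert q.1 y)))
    (hint1 : ∀ i j, IntegrableOn (fun u => |h u i * φ u j| * lam u y) W)
    (hint2 : ∀ i j, IntegrableOn (fun u => |h u i * lam1 u j|) W)
    (hint3 : ∀ i j, IntegrableOn
      (fun q : EuclideanSpace ℝ (Fin d) × EuclideanSpace ℝ (Fin d) =>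
        |h q.1 i * φ q.2 j| * (lam q.1 y * lam q.2 y + lam q.1 y * lam q.2 (insert q.1 y)))
      (W ×ˢ W)) :
    ∀ i j,
      (∫ u in W, h u i * φ u j * lam u y)
      + (∫ u in W, ∫ v in W,
          h u i * φ v j * (lam u y * lam v y - lam u y * lam v (insert u y)))
      - (∫ u in W, h u i * lam1 u j)
      = ∫ u in W, h u i * lam u y *
          (φ u j - lam1 u j / lam u y
            + ∫ v in W, φ v j * (lam v y * (1 - lam v (insert u y) / lam v y))) := by
  intro i j
  have mh : Measurable fun u => h u i := (measurable_pi_apply i).comp hmh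
  have mφ : Measurable fun u => φ u j := (measurable_pi_apply j).comp hmφ
  have ml : Measurable fun u => lam1 u j := (measurable_pi_apply j).comp hml1
  have I1 : IntegrableOn (fun u => h u i * φ u j * lam u y) W := by
    refine (hint1 i j).mono' ((mh.mul mφ).mul hmlam).aestronglyMeasurable
      (Filter.Eventually.of_forall fun u => ?_)
    rw [norm_mul, Real.norm_eq_abs, Real.norm_eq_abs, abs_of_pos (hpos u y)]
  have I2 : IntegrableOn (fun u => h u i * lam1 u j) W := by
    refine (hint2 i j).mono' (mh.mul ml).aestronglyMeasurable
      (Filter.Eventually.of_forall fun u => ?_)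
    rw [Real.norm_eq_abs]
  have I3 : IntegrableOn
      (fun q : EuclideanSpace ℝ (Fin d) × EuclideanSpace ℝ (Fin d) =>
        h q.1 i * φ q.2 j * (lam q.1 y * lam q.2 y - lam q.1 y * lam q.2 (insert q.1 y)))
      (W ×ˢ W) := by
    have m1 : Measurable (fun q : EuclideanSpace ℝ (Fin d) × EuclideanSpace ℝ (Fin d) =>
      lam q.1 y) := hmlam.comp measurable_fst
    have m2 : Measurable (fun q : EuclideanSpace ℝ (Fin d) × EuclideanSpace ℝ (Fin d) =>
      lam q.2 y) := hmlam.comp measurable_snd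
    refine (hint3 i j).mono' (((mh.comp measurable_fst).mul (mφ.comp measurable_snd)).mul
      ((m1.mul m2).sub (m1.mul hmlam2))).aestronglyMeasurable
      (Filter.Eventually.of_forall fun q => ?_)
    rw [norm_mul, Real.norm_eq_abs, Real.norm_eq_abs]
    refine mul_le_mul_of_nonneg_left ?_ (abs_nonneg _)
    have a := mul_pos (hpos q.1 y) (hpos q.2 y)
    have b := mul_pos (hpos q.1 y) (hpos q.2 (insert q.1 y))
    rw [abs_le]
    constructor <;> linarith
  have I4 : IntegrableOn (fun u => ∫ v in W,
      h u i * φ v j * (lam u y * lam v y - lam u y * lam v (insert u y))) W := by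
    rw [IntegrableOn, Measure.volume_eq_prod, ← Measure.prod_restrict] at I3
    exact I3.integral_prod_left
  rw [← integral_add I1 I4]
  refine (integral_sub (I1.add I4) I2).symm.trans ?_
  congr 1
  funext u
  have e : (∫ v in W, h u i * φ v j * (lam u y * lam v y - lam u y * lam v (insert u y)))
      = h u i * lam u y * ∫ v in W, φ v j * (lam v y * (1 - lam v (insert u y) / lam v y)) := by
    rw [← integral_const_mul]
    congr 1
    funext v
    have := (hpos v y).ne'
    field_simp
  have := (hpos u y).ne'
  simp only [Pi.add_apply]
  rw [e]
  field_simp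
  try ring
end

section
/- Fix a bounded measurable set W ⊆ ℝ^d, a finite configuration y ⊂ ℝ^d, a strictly positive Papangelou conditional intensity λ(u,y), measurable functions φ, λ⁽¹⁾ : W → ℝ^p, and suppose the semi-optimal Fredholm integral equation φ(u) + T_y φ(u) = λ⁽¹⁾(u)/λ(u,y) holds for every u ∈ W, where T_y φ(u) = ∫_W φ(v) λ(v,y){1 − λ(v, y∪{u})/λ(v,y)} dv. Then for every measurable h : W → ℝ^p satisfying the integrability conditions ∫_W |h_i(u) φ_j(u)| λ(u,y) du < ∞, ∫_W |h_i(u) λ⁽¹⁾_j(u)| du < ∞ and ∫_W ∫_W |h_i(u) φ_j(v)| { λ(u,y)λ(v,y) + λ(u,y)λ(v, y∪{u}) } du dv < ∞ for all i, j, one has ∫_W h(u) φ(u)ᵀ λ(u,y) du + ∫_W ∫_W h(u) φ(v)ᵀ { λ(u,y)λ(v,y) − λ(u,y)λ(v, y∪{u}) } du dv = ∫_W h(u) λ⁽¹⁾(u)ᵀ du. -/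
open MeasureTheory

/-- if `φ` solves the semi-optimal Fredholm equation
`φ(u) + T_y φ(u) = λ⁽¹⁾(u)/λ(u,y)` on `W`, then for every weight function `h`
satisfying the integrability conditions, the term `A` vanishes, i.e.
`∫ h φᵀ λ + ∫∫ h φᵀ {λλ − λ⁽²⁾} = ∫ h (λ⁽¹⁾)ᵀ`. Stated componentwise. -/
theorem statement_2 {d p : ℕ} [DecidableEq (EuclideanSpace ℝ (Fin d))]
    (W : Set (EuclideanSpace ℝ (Fin d))) (hWm : MeasurableSet W)
    (hWb : Bornology.IsBounded W)
    (y : Finset (EuclideanSpace ℝ (Fin d)))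
    (φ lam1 : EuclideanSpace ℝ (Fin d) → Fin p → ℝ)
    (lam : EuclideanSpace ℝ (Fin d) → Finset (EuclideanSpace ℝ (Fin d)) → ℝ)
    (hpos : ∀ u z, 0 < lam u z)
    (hmφ : Measurable φ) (hml1 : Measurable lam1)
    (hmlam : Measurable (fun u => lam u y))
    (hmlam2 : Measurable (fun q : EuclideanSpace ℝ (Fin d) × EuclideanSpace ℝ (Fin d) =>
      lam q.2 (insert q.1 y)))
    (hFredholm : ∀ u ∈ W, ∀ j,
      φ u j + (∫ v in W, φ v j * (lam v y * (1 - lam v (insert u y) / lam v y)))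
        = lam1 u j / lam u y) :
    ∀ h : EuclideanSpace ℝ (Fin d) → Fin p → ℝ, Measurable h →
    (∀ i j, IntegrableOn (fun u => |h u i * φ u j| * lam u y) W) →
    (∀ i j, IntegrableOn (fun u => |h u i * lam1 u j|) W) →
    (∀ i j, IntegrableOn
      (fun q : EuclideanSpace ℝ (Fin d) × EuclideanSpace ℝ (Fin d) =>
        |h q.1 i * φ q.2 j| * (lam q.1 y * lam q.2 y + lam q.1 y * lam q.2 (insert q.1 y)))
      (W ×ˢ W)) →
    ∀ i j,
      (∫ u in W, h u i * φ u j * lam u y)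
      + (∫ u in W, ∫ v in W,
          h u i * φ v j * (lam u y * lam v y - lam u y * lam v (insert u y)))
      = ∫ u in W, h u i * lam1 u j := by
  intro h hmh hI1 hI2 _ i j
  have mh : Measurable (fun u => h u i) := (measurable_pi_apply i).comp hmh
  have mφ : Measurable (fun u => φ u j) := (measurable_pi_apply j).comp hmφ
  have ml : Measurable (fun u => lam1 u j) := (measurable_pi_apply j).comp hml1
  have J1 : IntegrableOn (fun u => h u i * φ u j * lam u y) W := by
    refine Integrable.mono (hI1 i j) ((mh.mul mφ).mul hmlam).aestronglyMeasurable ?_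
    refine Filter.Eventually.of_forall fun u => ?_
    simp [abs_mul]
  have J2 : IntegrableOn (fun u => h u i * lam1 u j) W := by
    refine Integrable.mono (hI2 i j) (mh.mul ml).aestronglyMeasurable ?_
    refine Filter.Eventually.of_forall fun u => ?_
    simp [abs_mul]
  have key : (∫ u in W, ∫ v in W,
          h u i * φ v j * (lam u y * lam v y - lam u y * lam v (insert u y)))
      = ∫ u in W, (h u i * lam1 u j - h u i * φ u j * lam u y) := by
    refine setIntegral_congr_fun hWm fun u hu => ?_
    have e : ∀ v, h u i * φ v j * (lam u y * lam v y - lam u y * lam v (insert u y))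
        = (h u i * lam u y) * (φ v j * (lam v y * (1 - lam v (insert u y) / lam v y))) := by
      intro v
      have := (hpos v y).ne'
      field_simp
    simp only [e]
    rw [integral_const_mul, eq_sub_of_add_eq' (hFredholm u hu j)]
    have := (hpos u y).ne'
    field_simp
  rw [key, integral_sub J2 J1]
  ring
end
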